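/- Let w : ℝ³ → ℝ be a smooth solution of the PKP equation and let g : ℝ → ℝ be smooth. Define Q : ℝ³ → ℝ by Q = g(t)∂_y w + (2/3)y g'(t)∂ₓ w + (4/9)x y g''(t) + (8/81)y³ g'''(t). Then Q satisfies the linearized PKP equation at w; that is, the Kac–Moody flow Y(g) is a symmetry of the PKP equation for every smooth g. -/

import Mathlib

noncomputable section

/-- Partial derivative in the first variable `x`. -/
def dx (w : ℝ → ℝ → ℝ → ℝ) : ℝ → ℝ → ℝ → ℝ :=
  fun x y t => deriv (fun s => w s y t) x

/-- Partial derivative in the second variable `y`. -/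
def dy (w : ℝ → ℝ → ℝ → ℝ) : ℝ → ℝ → ℝ → ℝ :=
  fun x y t => deriv (fun s => w x s t) y

/-- Partial derivative in the third variable `t`. -/
def dt (w : ℝ → ℝ → ℝ → ℝ) : ℝ → ℝ → ℝ → ℝ :=
  fun x y t => deriv (fun s => w x y s) t

/-- Smoothness of a function of three real variables. -/
def Smooth3 (w : ℝ → ℝ → ℝ → ℝ) : Prop :=
  ContDiff ℝ (⊤ : ℕ∞) (fun p : ℝ × ℝ × ℝ => w p.1 p.2.1 p.2.2)

/-- The potential Kadomtsev–Petviashvili equation. -/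
def PKP (w : ℝ → ℝ → ℝ → ℝ) : Prop :=
  ∀ x y t, dx (dt w) x y t =
      (1/4) * dx (dx (dx (dx w))) x y t
    + (3/2) * dx w x y t * dx (dx w) x y t
    + (3/4) * dy (dy w) x y t

/-- The linearization of the PKP equation at a solution `w`. -/
def LinPKP (w Q : ℝ → ℝ → ℝ → ℝ) : Prop :=
  ∀ x y t, dx (dt Q) x y t =
      (1/4) * dx (dx (dx (dx Q))) x y t
    + (3/2) * (dx Q x y t * dx (dx w) x y t + dx w x y t * dx (dx Q) x y t)
    + (3/4) * dy (dy Q) x y t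

namespace Smooth3

variable {w : ℝ → ℝ → ℝ → ℝ}

lemma hasDerivAt_fderiv_x (hw : Smooth3 w) (x y t : ℝ) :
    HasDerivAt (fun s => w s y t)
      (fderiv ℝ (fun p : ℝ × ℝ × ℝ => w p.1 p.2.1 p.2.2) (x, y, t) (1, 0, 0)) x :=
  HasFDerivAt.comp_hasDerivAt (l := fun p : ℝ × ℝ × ℝ => w p.1 p.2.1 p.2.2) x
    ((hw.differentiable (by simp)) (x, y, t)).hasFDerivAt
    ((hasDerivAt_id x).prodMk ((hasDerivAt_const x y).prodMk (hasDerivAt_const x t)))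

lemma hasDerivAt_fderiv_y (hw : Smooth3 w) (x y t : ℝ) :
    HasDerivAt (fun s => w x s t)
      (fderiv ℝ (fun p : ℝ × ℝ × ℝ => w p.1 p.2.1 p.2.2) (x, y, t) (0, 1, 0)) y :=
  HasFDerivAt.comp_hasDerivAt (l := fun p : ℝ × ℝ × ℝ => w p.1 p.2.1 p.2.2) y
    ((hw.differentiable (by simp)) (x, y, t)).hasFDerivAt
    ((hasDerivAt_const y x).prodMk ((hasDerivAt_id y).prodMk (hasDerivAt_const y t)))

lemma hasDerivAt_fderiv_t (hw : Smooth3 w) (x y t : ℝ) :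
    HasDerivAt (fun s => w x y s)
      (fderiv ℝ (fun p : ℝ × ℝ × ℝ => w p.1 p.2.1 p.2.2) (x, y, t) (0, 0, 1)) t :=
  HasFDerivAt.comp_hasDerivAt (l := fun p : ℝ × ℝ × ℝ => w p.1 p.2.1 p.2.2) t
    ((hw.differentiable (by simp)) (x, y, t)).hasFDerivAt
    ((hasDerivAt_const t x).prodMk ((hasDerivAt_const t y).prodMk (hasDerivAt_id t)))

lemma contDiff_fderiv_apply (hw : Smooth3 w) (v : ℝ × ℝ × ℝ) :
    ContDiff ℝ (⊤ : ℕ∞)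
      (fun p => fderiv ℝ (fun p : ℝ × ℝ × ℝ => w p.1 p.2.1 p.2.2) p v) :=
  (hw.fderiv_right (m := (⊤ : ℕ∞)) (by simp)).clm_apply contDiff_const

lemma fderiv_fderiv_comm (hw : Smooth3 w) (p u v : ℝ × ℝ × ℝ) :
    fderiv ℝ (fun q => fderiv ℝ (fun p : ℝ × ℝ × ℝ => w p.1 p.2.1 p.2.2) q u) p v =
      fderiv ℝ (fun q => fderiv ℝ (fun p : ℝ × ℝ × ℝ => w p.1 p.2.1 p.2.2) q v) p u := by
  have hd : DifferentiableAt ℝ (fderiv ℝ (fun p : ℝ × ℝ × ℝ => w p.1 p.2.1 p.2.2)) p :=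
    (hw.fderiv_right (m := (⊤ : ℕ∞)) (by simp)).differentiable (by simp) p
  have hs : IsSymmSndFDerivAt ℝ (fun p : ℝ × ℝ × ℝ => w p.1 p.2.1 p.2.2) p :=
    hw.contDiffAt.isSymmSndFDerivAt (by simpa using WithTop.coe_le_coe.2 (le_top : (2 : ℕ∞) ≤ ⊤))
  rw [fderiv_clm_apply hd (differentiableAt_const u),
    fderiv_clm_apply hd (differentiableAt_const v)]
  simpa using hs v u

lemma dx_apply (hw : Smooth3 w) (x y t : ℝ) :
    dx w x y t = fderiv ℝ (fun p : ℝ × ℝ × ℝ => w p.1 p.2.1 p.2.2) (x, y, t) (1, 0, 0) :=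
  (hw.hasDerivAt_fderiv_x x y t).deriv

lemma hasDerivAt_x (hw : Smooth3 w) (x y t : ℝ) :
    HasDerivAt (fun s => w s y t) (dx w x y t) x :=
  (hw.hasDerivAt_fderiv_x x y t).differentiableAt.hasDerivAt

lemma dx (hw : Smooth3 w) : Smooth3 (dx w) := by
  unfold Smooth3
  simpa only [hw.dx_apply] using hw.contDiff_fderiv_apply (1, 0, 0)

lemma dy_apply (hw : Smooth3 w) (x y t : ℝ) :
    dy w x y t = fderiv ℝ (fun p : ℝ × ℝ × ℝ => w p.1 p.2.1 p.2.2) (x, y, t) (0, 1, 0) :=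
  (hw.hasDerivAt_fderiv_y x y t).deriv

lemma hasDerivAt_y (hw : Smooth3 w) (x y t : ℝ) :
    HasDerivAt (fun s => w x s t) (dy w x y t) y :=
  (hw.hasDerivAt_fderiv_y x y t).differentiableAt.hasDerivAt

lemma dy (hw : Smooth3 w) : Smooth3 (dy w) := by
  unfold Smooth3
  simpa only [hw.dy_apply] using hw.contDiff_fderiv_apply (0, 1, 0)

lemma dt_apply (hw : Smooth3 w) (x y t : ℝ) :
    dt w x y t = fderiv ℝ (fun p : ℝ × ℝ × ℝ => w p.1 p.2.1 p.2.2) (x, y, t) (0, 0, 1) :=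
  (hw.hasDerivAt_fderiv_t x y t).deriv

lemma hasDerivAt_t (hw : Smooth3 w) (x y t : ℝ) :
    HasDerivAt (fun s => w x y s) (dt w x y t) t :=
  (hw.hasDerivAt_fderiv_t x y t).differentiableAt.hasDerivAt

lemma dt (hw : Smooth3 w) : Smooth3 (dt w) := by
  unfold Smooth3
  simpa only [hw.dt_apply] using hw.contDiff_fderiv_apply (0, 0, 1)

lemma dx_dy (hw : Smooth3 w) : _root_.dx (_root_.dy w) = _root_.dy (_root_.dx w) := by
  funext x y t
  rw [hw.dy.dx_apply, hw.dx.dy_apply]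
  simp only [hw.dx_apply, hw.dy_apply]
  exact hw.fderiv_fderiv_comm _ _ _

lemma dt_dy (hw : Smooth3 w) : _root_.dt (_root_.dy w) = _root_.dy (_root_.dt w) := by
  funext x y t
  rw [hw.dy.dt_apply, hw.dt.dy_apply]
  simp only [hw.dt_apply, hw.dy_apply]
  exact hw.fderiv_fderiv_comm _ _ _

lemma dt_dx (hw : Smooth3 w) : _root_.dt (_root_.dx w) = _root_.dx (_root_.dt w) := by
  funext x y t
  rw [hw.dx.dt_apply, hw.dt.dx_apply]
  simp only [hw.dt_apply, hw.dx_apply]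
  exact hw.fderiv_fderiv_comm _ _ _

end Smooth3

/-- The Kac–Moody flow `Y(g)` is a symmetry of PKP. -/
theorem stmt3 (w : ℝ → ℝ → ℝ → ℝ) (hw : Smooth3 w) (hsol : PKP w)
    (g : ℝ → ℝ) (hg : ContDiff ℝ (⊤ : ℕ∞) g) :
    LinPKP w (fun x y t =>
      g t * dy w x y t
      + (2/3) * y * deriv g t * dx w x y t
      + (4/9) * x * y * deriv (deriv g) t
      + (8/81) * y ^ 3 * deriv (deriv (deriv g)) t) := by
  have hg1 : ContDiff ℝ (⊤ : ℕ∞) (deriv g) := (contDiff_infty_iff_deriv.1 hg).2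
  have hg2 : ContDiff ℝ (⊤ : ℕ∞) (deriv (deriv g)) := (contDiff_infty_iff_deriv.1 hg1).2
  have hg3 : ContDiff ℝ (⊤ : ℕ∞) (deriv (deriv (deriv g))) :=
    (contDiff_infty_iff_deriv.1 hg2).2
  have deriv_g {f : ℝ → ℝ} (hf : ContDiff ℝ (⊤ : ℕ∞) f) (t : ℝ) : HasDerivAt f (deriv f t) t :=
    (hf.differentiable (by simp) t).hasDerivAt
  set Q : ℝ → ℝ → ℝ → ℝ := fun x y t =>
      g t * dy w x y t
      + (2/3) * y * deriv g t * dx w x y t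
      + (4/9) * x * y * deriv (deriv g) t
      + (8/81) * y ^ 3 * deriv (deriv (deriv g)) t with hQ
  have hx := hw.dx
  have hy := hw.dy
  have ht := hw.dt
  have dx_comb (u v : ℝ → ℝ → ℝ → ℝ) (hu : Smooth3 u) (hv : Smooth3 v) (a b c d : ℝ → ℝ → ℝ) :
      dx (fun x y t => a y t * u x y t + b y t * v x y t + c y t * x + d y t) =
        fun x y t => a y t * dx u x y t + b y t * dx v x y t + c y t := by
    funext x y t
    have h := ((((hu.hasDerivAt_x x y t).const_mul (a y t)).add
      ((hv.hasDerivAt_x x y t).const_mul (b y t))).add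
      ((hasDerivAt_id x).const_mul (c y t))).add_const (d y t)
    refine (h.congr_deriv ?_).deriv
    ring
  have hQx : dx Q = fun x y t => g t * dx (dy w) x y t + (2/3) * y * deriv g t * dx (dx w) x y t
      + (4/9) * y * deriv (deriv g) t := by
    rw [← dx_comb _ _ hy hx (fun _ t => g t) (fun y t => (2/3) * y * deriv g t)
      (fun y t => (4/9) * y * deriv (deriv g) t)
      (fun y t => (8/81) * y ^ 3 * deriv (deriv (deriv g)) t)]
    congr 1
    funext x y t
    simp only [hQ]
    ring
  have hQxx : dx (dx Q) = fun x y t => g t * dx (dx (dy w)) x y t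
      + (2/3) * y * deriv g t * dx (dx (dx w)) x y t := by
    have h := dx_comb _ _ hy.dx hx.dx (fun _ t => g t) (fun y t => (2/3) * y * deriv g t)
      (fun _ _ => 0) (fun y t => (4/9) * y * deriv (deriv g) t)
    simpa only [hQx, zero_mul, add_zero] using h
  have hQxxxx : dx (dx (dx (dx Q))) = fun x y t => g t * dx (dx (dx (dx (dy w)))) x y t
      + (2/3) * y * deriv g t * dx (dx (dx (dx (dx w)))) x y t := by
    have h := dx_comb _ _ hy.dx.dx hx.dx.dx (fun _ t => g t) (fun y t => (2/3) * y * deriv g t)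
      (fun _ _ => 0) (fun _ _ => 0)
    have h' := dx_comb _ _ hy.dx.dx.dx hx.dx.dx.dx (fun _ t => g t)
      (fun y t => (2/3) * y * deriv g t) (fun _ _ => 0) (fun _ _ => 0)
    simp only [zero_mul, add_zero] at h h'
    rw [hQxx, h, h']
  have hQy : dy Q = fun x y t => g t * dy (dy w) x y t
      + (2/3) * deriv g t * (dx w x y t + y * dy (dx w) x y t)
      + (4/9) * x * deriv (deriv g) t + (8/27) * y ^ 2 * deriv (deriv (deriv g)) t := by
    funext x y t
    have h := ((((hy.hasDerivAt_y x y t).const_mul (g t)).add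
      ((((hasDerivAt_id y).const_mul (2/3)).mul_const (deriv g t)).mul
        (hx.hasDerivAt_y x y t))).add
      (((hasDerivAt_id y).const_mul ((4/9) * x)).mul_const (deriv (deriv g) t))).add
      (((hasDerivAt_pow 3 y).const_mul (8/81)).mul_const (deriv (deriv (deriv g)) t))
    refine (h.congr_deriv ?_).deriv
    simp only [id]
    ring
  have hQyy (x y t : ℝ) : dy (dy Q) x y t = g t * dy (dy (dy w)) x y t
      + (2/3) * deriv g t * (2 * dy (dx w) x y t + y * dy (dy (dx w)) x y t)
      + (16/27) * y * deriv (deriv (deriv g)) t := by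
    rw [hQy]
    have h := ((((hy.dy.hasDerivAt_y x y t).const_mul (g t)).add
      (((hx.hasDerivAt_y x y t).add
        ((hasDerivAt_id y).mul (hx.dy.hasDerivAt_y x y t))).const_mul ((2/3) * deriv g t))).add
      (hasDerivAt_const y ((4/9) * x * deriv (deriv g) t))).add
      (((hasDerivAt_pow 2 y).const_mul (8/27)).mul_const (deriv (deriv (deriv g)) t))
    refine (h.congr_deriv ?_).deriv
    simp only [id]
    ring
  have hQt : dt Q = fun x y t => deriv g t * dy w x y t + g t * dt (dy w) x y t
      + (2/3) * y * (deriv (deriv g) t * dx w x y t + deriv g t * dt (dx w) x y t)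
      + (4/9) * x * y * deriv (deriv (deriv g)) t
      + (8/81) * y ^ 3 * deriv (deriv (deriv (deriv g))) t := by
    funext x y t
    have h := ((((deriv_g hg t).mul (hy.hasDerivAt_t x y t)).add
      (((deriv_g hg1 t).const_mul ((2/3) * y)).mul (hx.hasDerivAt_t x y t))).add
      ((deriv_g hg2 t).const_mul ((4/9) * x * y))).add
      ((deriv_g hg3 t).const_mul ((8/81) * y ^ 3))
    refine (h.congr_deriv ?_).deriv
    ring
  have hQtx (x y t : ℝ) : dx (dt Q) x y t = deriv g t * dx (dy w) x y t
      + g t * dx (dt (dy w)) x y t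
      + (2/3) * y * (deriv (deriv g) t * dx (dx w) x y t + deriv g t * dx (dt (dx w)) x y t)
      + (4/9) * y * deriv (deriv (deriv g)) t := by
    rw [hQt]
    have h := (((((hy.hasDerivAt_x x y t).const_mul (deriv g t)).add
      ((hy.dt.hasDerivAt_x x y t).const_mul (g t))).add
      ((((hx.hasDerivAt_x x y t).const_mul (deriv (deriv g) t)).add
        ((hx.dt.hasDerivAt_x x y t).const_mul (deriv g t))).const_mul ((2/3) * y))).add
      ((((hasDerivAt_id x).const_mul (4/9)).mul_const y).mul_const
        (deriv (deriv (deriv g)) t))).add_const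
      ((8/81) * y ^ 3 * deriv (deriv (deriv (deriv g))) t)
    refine (h.congr_deriv ?_).deriv
    ring
  have hfun : dx (dt w) = fun x y t => (1/4) * dx (dx (dx (dx w))) x y t
      + (3/2) * dx w x y t * dx (dx w) x y t + (3/4) * dy (dy w) x y t := by
    funext x y t
    exact hsol x y t
  have hPx (x y t : ℝ) : dx (dx (dt w)) x y t = (1/4) * dx (dx (dx (dx (dx w)))) x y t
      + (3/2) * (dx (dx w) x y t * dx (dx w) x y t + dx w x y t * dx (dx (dx w)) x y t)
      + (3/4) * dx (dy (dy w)) x y t := by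
    rw [hfun]
    have h := (((hx.dx.dx.dx.hasDerivAt_x x y t).const_mul (1/4)).add
      (((hx.hasDerivAt_x x y t).const_mul (3/2)).mul (hx.dx.hasDerivAt_x x y t))).add
      ((hy.dy.hasDerivAt_x x y t).const_mul (3/4))
    refine (h.congr_deriv ?_).deriv
    ring
  have hPy (x y t : ℝ) : dy (dx (dt w)) x y t = (1/4) * dy (dx (dx (dx (dx w)))) x y t
      + (3/2) * (dy (dx w) x y t * dx (dx w) x y t + dx w x y t * dy (dx (dx w)) x y t)
      + (3/4) * dy (dy (dy w)) x y t := by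
    rw [hfun]
    have h := (((hx.dx.dx.dx.hasDerivAt_y x y t).const_mul (1/4)).add
      (((hx.hasDerivAt_y x y t).const_mul (3/2)).mul (hx.dx.hasDerivAt_y x y t))).add
      ((hy.dy.hasDerivAt_y x y t).const_mul (3/4))
    refine (h.congr_deriv ?_).deriv
    ring
  intro x y t
  have hPx' := hPx x y t
  have hPy' := hPy x y t
  rw [hQtx, hQxxxx, hQxx, hQx, hQyy]
  simp only [hw.dt_dy, hw.dt_dx, hw.dx_dy, hx.dx_dy, hx.dx.dx_dy, hx.dx.dx.dx_dy, ht.dx_dy,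
    hy.dx_dy] at hPx' hPy' ⊢
  linear_combination g t * hPy' + (2/3) * y * deriv g t * hPx'
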